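/- arXiv:2110.07004 — 3 statements merged into one kernel-verified Lean document; each statement's English description precedes it below -/
import Mathlib

section
/- The Jacobian of the N-step gradient-descent output is Lipschitz continuous: for all x₁, x₂ ∈ ℝ^p, ‖J_N(x₁) − J_N(x₂)‖_F ≤ L_J ‖x₁ − x₂‖, where L_J = (1 + L/μ_g)(τ/μ_g + ρL/μ_g²) and ‖·‖_F denotes the Frobenius norm. -/
open MeasureTheory ProbabilityTheory Real

noncomputable section

/-- `Vec n` is the Euclidean space `ℝ^n`. -/
abbrev Vec (n : ℕ) := EuclideanSpace ℝ (Fin n)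

/-- Frobenius norm of a (continuous) linear map from `ℝ^n`, computed columnwise. -/
def frob {n : ℕ} {F : Type*} [NormedAddCommGroup F] [NormedSpace ℝ F] (A : Vec n →L[ℝ] F) : ℝ :=
  Real.sqrt (∑ j, ‖A (EuclideanSpace.single j 1)‖ ^ 2)

/-- The inner gradient-descent iterates `y^t(x)`. -/
def yIter {p d : ℕ} (g : Vec p → Vec d → ℝ) (α : ℝ) (y0 : Vec d) : ℕ → Vec p → Vec d
  | 0, _ => y0
  | (t + 1), x => yIter g α y0 t x - α • gradient (g x) (yIter g α y0 t x)

/-- The Jacobian `J_N(x) = ∂ y^N(x) / ∂ x`. -/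
def Jn {p d : ℕ} (g : Vec p → Vec d → ℝ) (α : ℝ) (y0 : Vec d) (N : ℕ) (x : Vec p) :
    Vec p →L[ℝ] Vec d :=
  fderiv ℝ (yIter g α y0 N) x

lemma frob_eq_norm_toLp {n : ℕ} {F : Type*} [NormedAddCommGroup F] [NormedSpace ℝ F]
    (A : Vec n →L[ℝ] F) :
    frob A = ‖WithLp.toLp 2 (fun j : Fin n => A (EuclideanSpace.single j 1))‖ := by
  rw [PiLp.norm_eq_of_L2, frob]

lemma frob_nonneg {n : ℕ} {F : Type*} [NormedAddCommGroup F] [NormedSpace ℝ F]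
    (A : Vec n →L[ℝ] F) : 0 ≤ frob A :=
  Real.sqrt_nonneg _

lemma frob_sub_le {n : ℕ} {F : Type*} [NormedAddCommGroup F] [NormedSpace ℝ F]
    (A B : Vec n →L[ℝ] F) : frob (A - B) ≤ frob A + frob B := by
  simp only [frob_eq_norm_toLp]
  exact norm_sub_le (WithLp.toLp 2 fun j : Fin n => A (EuclideanSpace.single j 1))
    (WithLp.toLp 2 fun j : Fin n => B (EuclideanSpace.single j 1))

lemma frob_add_le {n : ℕ} {F : Type*} [NormedAddCommGroup F] [NormedSpace ℝ F]
    (A B : Vec n →L[ℝ] F) : frob (A + B) ≤ frob A + frob B := by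
  simp only [frob_eq_norm_toLp]
  exact norm_add_le (WithLp.toLp 2 fun j : Fin n => A (EuclideanSpace.single j 1))
    (WithLp.toLp 2 fun j : Fin n => B (EuclideanSpace.single j 1))

lemma frob_smul {n : ℕ} {F : Type*} [NormedAddCommGroup F] [NormedSpace ℝ F]
    (c : ℝ) (A : Vec n →L[ℝ] F) : frob (c • A) = |c| * frob A := by
  simp only [frob_eq_norm_toLp]
  exact norm_smul c (WithLp.toLp 2 fun j : Fin n => A (EuclideanSpace.single j 1))

lemma frob_comp_le_of_bound {n : ℕ} {F G : Type*} [NormedAddCommGroup F] [NormedSpace ℝ F]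
    [NormedAddCommGroup G] [NormedSpace ℝ G] (T : F →L[ℝ] G) (A : Vec n →L[ℝ] F)
    {c : ℝ} (hc : 0 ≤ c) (hT : ∀ v, ‖T v‖ ≤ c * ‖v‖) :
    frob (T ∘L A) ≤ c * frob A := by
  rw [frob, frob, ← Real.sqrt_sq hc, ← Real.sqrt_mul (sq_nonneg c), Finset.mul_sum]
  gcongr with j
  rw [← mul_pow]
  gcongr
  simpa using hT _

lemma frob_sq_eq_sum_adjoint {n m : ℕ} (A : Vec n →L[ℝ] Vec m) :
    ∑ j, ‖A (EuclideanSpace.single j 1)‖ ^ 2 =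
      ∑ i, ‖ContinuousLinearMap.adjoint A (EuclideanSpace.single i 1)‖ ^ 2 := by
  simp only [EuclideanSpace.real_norm_sq_eq]
  rw [Finset.sum_comm]
  refine Finset.sum_congr rfl fun i _ => Finset.sum_congr rfl fun j _ => ?_
  have h := ContinuousLinearMap.adjoint_inner_left A
    (EuclideanSpace.single j (1 : ℝ)) (EuclideanSpace.single i (1 : ℝ))
  rw [EuclideanSpace.inner_single_left, EuclideanSpace.inner_single_right] at h
  simp at h
  rw [h]

lemma frob_adjoint {n m : ℕ} (A : Vec n →L[ℝ] Vec m) :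
    frob (ContinuousLinearMap.adjoint A) = frob A := by
  rw [frob, frob, frob_sq_eq_sum_adjoint A]

lemma frob_comp_le_mul_norm {n m k : ℕ} (A : Vec m →L[ℝ] Vec k) (B : Vec n →L[ℝ] Vec m) :
    frob (A ∘L B) ≤ frob A * ‖B‖ := by
  rw [← frob_adjoint, ContinuousLinearMap.adjoint_comp, ← frob_adjoint A, mul_comm]
  refine frob_comp_le_of_bound _ _ (norm_nonneg _) fun v => ?_
  rw [← LinearIsometryEquiv.norm_map ContinuousLinearMap.adjoint B]
  exact ContinuousLinearMap.le_opNorm _ v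

/-- A symmetric operator whose quadratic form lies between `0` and `c ‖·‖²` has norm at most `c`. -/
lemma norm_apply_le_of_inner_le {E : Type*} [NormedAddCommGroup E] [InnerProductSpace ℝ E]
    (T : E →L[ℝ] E) {c : ℝ} (hsymm : ∀ v w, inner ℝ (T v) w = inner ℝ (T w) v)
    (hpos : ∀ v, 0 ≤ inner ℝ (T v) v) (hle : ∀ v, inner ℝ (T v) v ≤ c * ‖v‖ ^ 2)
    (v : E) : ‖T v‖ ≤ c * ‖v‖ := by
  rcases eq_or_ne v 0 with rfl | hv
  · simp
  have hv' : 0 < ‖v‖ := norm_pos_iff.2 hv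
  have hc : 0 ≤ c := by
    by_contra! h
    nlinarith [hpos v, hle v, pow_pos hv' 2]
  have hCS := LinearMap.BilinForm.apply_sq_le_of_symm ((innerₗ E).comp T.toLinearMap)
    (fun x => hpos x) ⟨fun x y => hsymm x y⟩ v (T v)
  simp only [LinearMap.comp_apply, ContinuousLinearMap.coe_coe, innerₗ_apply_apply,
    real_inner_self_eq_norm_sq] at hCS
  have h1 : (‖T v‖ ^ 2) ^ 2 ≤ (c * ‖v‖ ^ 2) * (c * ‖T v‖ ^ 2) :=
    hCS.trans (mul_le_mul (hle v) (hle _) (hpos _) (by positivity))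
  rcases eq_or_ne (T v) 0 with h0 | h0
  · rw [h0, norm_zero]; positivity
  have h0' : 0 < ‖T v‖ := norm_pos_iff.2 h0
  refine le_of_sq_le_sq ?_ (by positivity)
  refine le_of_mul_le_mul_right ?_ (pow_pos h0' 2)
  nlinarith

section Hessian

variable {E : Type*} [NormedAddCommGroup E] [InnerProductSpace ℝ E] [CompleteSpace E]

lemma differentiable_gradient {h : E → ℝ} (hh : ContDiff ℝ 2 h) :
    Differentiable ℝ (gradient h) := by
  have : Differentiable ℝ (fderiv ℝ h) :=
    (hh.fderiv_right (m := 1) (by norm_num)).differentiable (by norm_num)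
  exact ((InnerProductSpace.toDual ℝ E).symm.toContinuousLinearEquiv
    |>.differentiable).comp this

lemma inner_fderiv_gradient {h : E → ℝ} (hh : ContDiff ℝ 2 h) (y v w : E) :
    inner ℝ (fderiv ℝ (gradient h) y v) w = fderiv ℝ (fderiv ℝ h) y v w := by
  have hd : DifferentiableAt ℝ (fderiv ℝ h) y :=
    (hh.fderiv_right (m := 1) (by norm_num)).differentiable (by norm_num) y
  have h1 := (((differentiable_gradient hh) y).hasFDerivAt.inner ℝ
    (hasFDerivAt_const w y))
  have h2 := hd.hasFDerivAt.clm_apply (hasFDerivAt_const w y)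
  simp only [inner_gradient_left] at h1
  have h3 := congrArg (fun A : E →L[ℝ] ℝ => A v) (h1.unique h2)
  simpa [fderivInnerCLM_apply] using h3

lemma inner_fderiv_gradient_comm {h : E → ℝ} (hh : ContDiff ℝ 2 h) (y v w : E) :
    inner ℝ (fderiv ℝ (gradient h) y v) w = inner ℝ (fderiv ℝ (gradient h) y w) v := by
  rw [inner_fderiv_gradient hh, inner_fderiv_gradient hh]
  exact (hh.contDiffAt.isSymmSndFDerivAt (by simp)).eq v w

lemma StrongConvexOn.le_inner_fderiv_gradient {h : E → ℝ} {m : ℝ} (hh : ContDiff ℝ 2 h)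
    (hsc : StrongConvexOn Set.univ m h) (y v : E) :
    m * ‖v‖ ^ 2 ≤ inner ℝ (fderiv ℝ (gradient h) y v) v := by
  have hconv := (strongConvexOn_iff_convex.1 hsc).comp_affineMap (AffineMap.lineMap y (y + v))
  have hline (t : ℝ) : HasDerivAt (fun t : ℝ => y + t • v) v t := by
    simpa using ((hasDerivAt_id t).smul_const v).const_add y
  have hφ (t : ℝ) : HasDerivAt (fun t : ℝ => h (y + t • v) - m / 2 * ‖y + t • v‖ ^ 2)
      (inner ℝ (gradient h (y + t • v)) v - m * inner ℝ (y + t • v) v) t := by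
    have h1 := ((hh.differentiable (by norm_num)) (y + t • v)).hasFDerivAt.comp_hasDerivAt t
      (hline t)
    have h2 := ((hline t).norm_sq).const_mul (m / 2)
    rw [inner_gradient_left]
    convert! h1.sub h2 using 1
    ring
  have hfun : ((fun x => h x - m / (2 : ℝ) * ‖x‖ ^ 2) ∘ (AffineMap.lineMap y (y + v) : ℝ →ᵃ[ℝ] E))
      = fun t : ℝ => h (y + t • v) - m / 2 * ‖y + t • v‖ ^ 2 := by
    funext t
    simp [AffineMap.lineMap_apply, add_comm]
  rw [hfun, Set.preimage_univ] at hconv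
  have hmono : Monotone
      (fun t : ℝ => inner ℝ (gradient h (y + t • v)) v - m * inner ℝ (y + t • v) v) := by
    have := hconv.monotoneOn_deriv (fun t _ => (hφ t).differentiableAt)
    rw [monotoneOn_univ] at this
    convert this using 2 with t
    exact (hφ t).deriv.symm
  have hline0 := hline 0
  have hd : HasDerivAt
      (fun t : ℝ => inner ℝ (gradient h (y + t • v)) v - m * inner ℝ (y + t • v) v)
      (inner ℝ (fderiv ℝ (gradient h) y v) v - m * ‖v‖ ^ 2) 0 := by
    have hg : HasDerivAt (fun t : ℝ => gradient h (y + t • v)) (fderiv ℝ (gradient h) y v) 0 := by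
      have := ((differentiable_gradient hh) (y + (0 : ℝ) • v)).hasFDerivAt.comp_hasDerivAt 0 hline0
      simpa using! this
    have h1 := hg.inner ℝ (hasDerivAt_const 0 v)
    have h2 := (hline0.inner ℝ (hasDerivAt_const 0 v)).const_mul m
    convert! h1.sub h2 using 1
    simp
  have := hmono.deriv_nonneg (x := 0)
  rw [hd.deriv] at this
  linarith

lemma norm_sub_smul_fderiv_gradient_le {h : E → ℝ} {m L α : ℝ} (hh : ContDiff ℝ 2 h)
    (hsc : StrongConvexOn Set.univ m h) {y : E} (hL : ‖fderiv ℝ (gradient h) y‖ ≤ L)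
    (hα : 0 ≤ α) (hαL : α * L ≤ 1) (v : E) :
    ‖v - α • fderiv ℝ (gradient h) y v‖ ≤ (1 - α * m) * ‖v‖ := by
  refine norm_apply_le_of_inner_le
    (ContinuousLinearMap.id ℝ E - α • fderiv ℝ (gradient h) y) (fun v w => ?_) (fun v => ?_)
    (fun v => ?_) v
  · simp [inner_sub_left, inner_smul_left, inner_fderiv_gradient_comm hh y v w,
      real_inner_comm]
  · have h1 : inner ℝ (fderiv ℝ (gradient h) y v) v ≤ L * ‖v‖ ^ 2 := by
      refine (real_inner_le_norm _ _).trans ?_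
      rw [pow_two, ← mul_assoc]
      gcongr
      exact (ContinuousLinearMap.le_opNorm _ v).trans (by gcongr)
    simp only [sub_apply, ContinuousLinearMap.id_apply,
      smul_apply, inner_sub_left, inner_smul_left,
      real_inner_self_eq_norm_sq, RCLike.conj_to_real]
    nlinarith [mul_le_mul_of_nonneg_left h1 hα, sq_nonneg ‖v‖]
  · have h1 := hsc.le_inner_fderiv_gradient hh y v
    simp only [sub_apply, ContinuousLinearMap.id_apply,
      smul_apply, inner_sub_left, inner_smul_left,
      real_inner_self_eq_norm_sq, RCLike.conj_to_real]
    nlinarith [mul_le_mul_of_nonneg_left h1 hα]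

end Hessian

lemma contDiff_gradient_snd {p d : ℕ} {g : Vec p → Vec d → ℝ}
    (hg : ContDiff ℝ 2 (fun w : Vec p × Vec d => g w.1 w.2)) :
    ContDiff ℝ 1 (fun w : Vec p × Vec d => gradient (g w.1) w.2) := by
  have hfd (w : Vec p × Vec d) : fderiv ℝ (g w.1) w.2 =
      fderiv ℝ (fun w : Vec p × Vec d => g w.1 w.2) w ∘L
        ContinuousLinearMap.inr ℝ (Vec p) (Vec d) := by
    have h1 := (hg.differentiable (by norm_num) (w.1, w.2)).hasFDerivAt
    exact (h1.comp w.2 (hasFDerivAt_prodMk_right w.1 w.2)).fderiv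
  simp only [gradient, hfd]
  refine (InnerProductSpace.toDual ℝ (Vec d)).symm.toContinuousLinearEquiv.contDiff.comp ?_
  exact (hg.fderiv_right (m := 1) (by norm_num)).clm_comp contDiff_const

/-- Chain rule for the gradient `(x, y) ↦ ∇_y g(x, y)` along the curve `x ↦ (x, u x)`. -/
lemma hasFDerivAt_gradient_comp {p d : ℕ} {g : Vec p → Vec d → ℝ}
    (hg : ContDiff ℝ 2 (fun w : Vec p × Vec d => g w.1 w.2)) {u : Vec p → Vec d}
    {u' : Vec p →L[ℝ] Vec d} {x : Vec p} (hu : HasFDerivAt u u' x) :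
    HasFDerivAt (fun x => gradient (g x) (u x))
      (fderiv ℝ (fun x' => gradient (g x') (u x)) x + fderiv ℝ (gradient (g x)) (u x) ∘L u') x := by
  have hG : HasFDerivAt (fun w : Vec p × Vec d => gradient (g w.1) w.2)
      (fderiv ℝ (fun w : Vec p × Vec d => gradient (g w.1) w.2) (x, u x)) (x, u x) :=
    ((contDiff_gradient_snd hg).differentiable (by norm_num) _).hasFDerivAt
  have h1 : HasFDerivAt (fun x' => gradient (g x') (u x)) _ x :=
    HasFDerivAt.comp (f := fun x' => (x', u x)) x hG (hasFDerivAt_prodMk_left x (u x))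
  have h2 : HasFDerivAt (gradient (g x)) _ (u x) :=
    HasFDerivAt.comp (f := fun y => (x, y)) (u x) hG (hasFDerivAt_prodMk_right x (u x))
  rw [h1.fderiv, h2.fderiv]
  convert! HasFDerivAt.comp (f := fun x => (x, u x)) x hG ((hasFDerivAt_id x).prodMk hu) using 1
  ext v : 1
  simp [← map_add]

lemma differentiable_yIter {p d : ℕ} {g : Vec p → Vec d → ℝ}
    (hg : ContDiff ℝ 2 (fun w : Vec p × Vec d => g w.1 w.2)) (α : ℝ) (y0 : Vec d) (t : ℕ) :
    Differentiable ℝ (yIter g α y0 t) := by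
  induction t with
  | zero => exact differentiable_const y0
  | succ t ih =>
    intro x
    exact (ih x).sub
      ((hasFDerivAt_gradient_comp hg (ih x).hasFDerivAt).differentiableAt.const_smul α)

lemma Jn_zero {p d : ℕ} (g : Vec p → Vec d → ℝ) (α : ℝ) (y0 : Vec d) (x : Vec p) :
    Jn g α y0 0 x = 0 :=
  (hasFDerivAt_const y0 x).fderiv

lemma Jn_succ {p d : ℕ} {g : Vec p → Vec d → ℝ}
    (hg : ContDiff ℝ 2 (fun w : Vec p × Vec d => g w.1 w.2)) (α : ℝ) (y0 : Vec d) (t : ℕ)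
    (x : Vec p) :
    Jn g α y0 (t + 1) x =
      (ContinuousLinearMap.id ℝ (Vec d) -
          α • fderiv ℝ (gradient (g x)) (yIter g α y0 t x)) ∘L Jn g α y0 t x -
        α • fderiv ℝ (fun x' => gradient (g x') (yIter g α y0 t x)) x := by
  have h := (differentiable_yIter hg α y0 t x).hasFDerivAt
  have h1 := (h.sub ((hasFDerivAt_gradient_comp hg h).const_smul α)).fderiv
  refine Eq.trans h1 ?_
  ext v : 1
  simp [Jn]
  abel

/-- The iterates have Jacobian bounded by `L / μ`, provided each step contracts by `1 - α μ`
and the mixed partials are bounded by `L`. -/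
lemma norm_Jn_le {p d : ℕ} {g : Vec p → Vec d → ℝ}
    (hg : ContDiff ℝ 2 (fun w : Vec p × Vec d => g w.1 w.2)) {α μ L : ℝ} (hα : 0 ≤ α) (hμ : 0 < μ)
    (hαμ : α * μ ≤ 1) (hL : 0 ≤ L)
    (hH : ∀ x y v, ‖v - α • fderiv ℝ (gradient (g x)) y v‖ ≤ (1 - α * μ) * ‖v‖)
    (hC : ∀ x y, ‖fderiv ℝ (fun x' => gradient (g x') y) x‖ ≤ L) (y0 : Vec d) (t : ℕ)
    (x : Vec p) : ‖Jn g α y0 t x‖ ≤ L / μ := by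
  induction t with
  | zero => rw [Jn_zero, norm_zero]; positivity
  | succ t ih =>
    rw [Jn_succ hg]
    set y := yIter g α y0 t x
    have hT : ‖ContinuousLinearMap.id ℝ (Vec d) - α • fderiv ℝ (gradient (g x)) y‖ ≤ 1 - α * μ :=
      ContinuousLinearMap.opNorm_le_bound _ (by linarith) fun v => hH x y v
    calc _ ≤ ‖ContinuousLinearMap.id ℝ (Vec d) - α • fderiv ℝ (gradient (g x)) y‖ *
              ‖Jn g α y0 t x‖ + α * ‖fderiv ℝ (fun x' => gradient (g x') y) x‖ := by
            refine (norm_sub_le _ _).trans (add_le_add (ContinuousLinearMap.opNorm_comp_le _ _) ?_)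
            rw [norm_smul, Real.norm_of_nonneg hα]
      _ ≤ (1 - α * μ) * (L / μ) + α * L := by
            gcongr
            exact hC x y
      _ = L / μ := by field_simp; ring

lemma frob_Jn_sub_le {p d : ℕ} {g : Vec p → Vec d → ℝ}
    (hg : ContDiff ℝ 2 (fun w : Vec p × Vec d => g w.1 w.2)) {α μ L ρ τ : ℝ} (hα : 0 ≤ α)
    (hμ : 0 < μ) (hαμ : α * μ ≤ 1) (hL : 0 ≤ L) (hρ0 : 0 ≤ ρ) (hτ0 : 0 ≤ τ)
    (hH : ∀ x y v, ‖v - α • fderiv ℝ (gradient (g x)) y v‖ ≤ (1 - α * μ) * ‖v‖)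
    (hC : ∀ x y, ‖fderiv ℝ (fun x' => gradient (g x') y) x‖ ≤ L)
    (hρ : ∀ x₁ y₁ x₂ y₂,
        frob (fderiv ℝ (gradient (g x₁)) y₁ - fderiv ℝ (gradient (g x₂)) y₂) ≤
        ρ * Real.sqrt (‖x₁ - x₂‖ ^ 2 + ‖y₁ - y₂‖ ^ 2))
    (hτ : ∀ x₁ y₁ x₂ y₂,
        frob (fderiv ℝ (fun x => gradient (g x) y₁) x₁ -
              fderiv ℝ (fun x => gradient (g x) y₂) x₂) ≤
        τ * Real.sqrt (‖x₁ - x₂‖ ^ 2 + ‖y₁ - y₂‖ ^ 2))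
    (y0 : Vec d) (t : ℕ) (x₁ x₂ : Vec p) :
    frob (Jn g α y0 t x₁ - Jn g α y0 t x₂) ≤
      (1 + L / μ) * (τ / μ + ρ * L / μ ^ 2) * ‖x₁ - x₂‖ := by
  induction t with
  | zero =>
    have h0 : frob (Jn g α y0 0 x₁ - Jn g α y0 0 x₂) = 0 := by simp [Jn_zero, frob]
    rw [h0]
    positivity
  | succ t ih =>
    have hJ := norm_Jn_le hg hα hμ hαμ hL hH hC y0 t
    have hy : ‖yIter g α y0 t x₁ - yIter g α y0 t x₂‖ ≤ L / μ * ‖x₁ - x₂‖ :=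
      convex_univ.norm_image_sub_le_of_norm_fderiv_le
        (fun x _ => differentiable_yIter hg α y0 t x) (fun x _ => hJ x) trivial trivial
    rw [Jn_succ hg, Jn_succ hg]
    set y₁ := yIter g α y0 t x₁
    set y₂ := yIter g α y0 t x₂
    set H₁ := fderiv ℝ (gradient (g x₁)) y₁
    set H₂ := fderiv ℝ (gradient (g x₂)) y₂
    set C₁ := fderiv ℝ (fun x => gradient (g x) y₁) x₁
    set C₂ := fderiv ℝ (fun x => gradient (g x) y₂) x₂
    set J₁ := Jn g α y0 t x₁
    set J₂ := Jn g α y0 t x₂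
    have hs : Real.sqrt (‖x₁ - x₂‖ ^ 2 + ‖y₁ - y₂‖ ^ 2) ≤ (1 + L / μ) * ‖x₁ - x₂‖ := by
      refine Real.sqrt_le_iff.2 ⟨by positivity, ?_⟩
      have h1 : ‖y₁ - y₂‖ ^ 2 ≤ (L / μ * ‖x₁ - x₂‖) ^ 2 := by gcongr
      have h2 : 0 ≤ L / μ * ‖x₁ - x₂‖ * ‖x₁ - x₂‖ := by positivity
      nlinarith
    have hsplit : ((ContinuousLinearMap.id ℝ (Vec d) - α • H₁) ∘L J₁ - α • C₁) -
        ((ContinuousLinearMap.id ℝ (Vec d) - α • H₂) ∘L J₂ - α • C₂) =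
        (ContinuousLinearMap.id ℝ (Vec d) - α • H₁) ∘L (J₁ - J₂) -
          α • ((H₁ - H₂) ∘L J₂ + (C₁ - C₂)) := by
      ext v : 1
      simp only [sub_apply, ContinuousLinearMap.comp_apply,
        smul_apply, add_apply,
        ContinuousLinearMap.id_apply, map_sub]
      module
    rw [hsplit]
    set S := (1 + L / μ) * ‖x₁ - x₂‖ with hS
    calc _ ≤ frob ((ContinuousLinearMap.id ℝ (Vec d) - α • H₁) ∘L (J₁ - J₂)) +
            frob (α • ((H₁ - H₂) ∘L J₂ + (C₁ - C₂))) := frob_sub_le _ _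
      _ ≤ (1 - α * μ) * frob (J₁ - J₂) + α * (frob (H₁ - H₂) * ‖J₂‖ + frob (C₁ - C₂)) := by
          rw [frob_smul, abs_of_nonneg hα]
          gcongr
          · exact frob_comp_le_of_bound _ _ (by linarith) fun v => hH x₁ y₁ v
          · exact (frob_add_le _ _).trans (by gcongr; exact frob_comp_le_mul_norm _ _)
      _ ≤ (1 - α * μ) * ((1 + L / μ) * (τ / μ + ρ * L / μ ^ 2) * ‖x₁ - x₂‖) +
            α * (ρ * S * (L / μ) + τ * S) := by
          gcongr
          · exact (hρ x₁ y₁ x₂ y₂).trans (mul_le_mul_of_nonneg_left hs hρ0)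
          · exact hJ x₂
          · exact (hτ x₁ y₁ x₂ y₂).trans (mul_le_mul_of_nonneg_left hs hτ0)
      _ = (1 + L / μ) * (τ / μ + ρ * L / μ ^ 2) * ‖x₁ - x₂‖ := by
          rw [hS]; field_simp; ring

theorem statement0 {p d : ℕ} (f g : Vec p → Vec d → ℝ)
    (Lf Lg μg ρ τ M : ℝ) (hμg : 0 < μg)
    (hf2 : ContDiff ℝ 2 (fun w : Vec p × Vec d => f w.1 w.2))
    (hg2 : ContDiff ℝ 2 (fun w : Vec p × Vec d => g w.1 w.2))
    (hsc : ∀ x, StrongConvexOn Set.univ μg (g x))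
    (ystar : Vec p → Vec d)
    (hmin : ∀ x y, g x (ystar x) ≤ g x y)
    (hLg : ∀ x₁ y₁ x₂ y₂, Real.sqrt
        (‖gradient (fun x => g x y₁) x₁ - gradient (fun x => g x y₂) x₂‖ ^ 2 +
         ‖gradient (g x₁) y₁ - gradient (g x₂) y₂‖ ^ 2) ≤
        Lg * Real.sqrt (‖x₁ - x₂‖ ^ 2 + ‖y₁ - y₂‖ ^ 2))
    (hρ : ∀ x₁ y₁ x₂ y₂,
        frob (fderiv ℝ (gradient (g x₁)) y₁ - fderiv ℝ (gradient (g x₂)) y₂) ≤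
        ρ * Real.sqrt (‖x₁ - x₂‖ ^ 2 + ‖y₁ - y₂‖ ^ 2))
    (hτ : ∀ x₁ y₁ x₂ y₂,
        frob (fderiv ℝ (fun x => gradient (g x) y₁) x₁ -
              fderiv ℝ (fun x => gradient (g x) y₂) x₂) ≤
        τ * Real.sqrt (‖x₁ - x₂‖ ^ 2 + ‖y₁ - y₂‖ ^ 2))
    (hM : ∀ x₁ y₁ x₂ y₂, |f x₁ y₁ - f x₂ y₂| ≤ M * Real.sqrt (‖x₁ - x₂‖ ^ 2 + ‖y₁ - y₂‖ ^ 2))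
    (hLf : ∀ x₁ y₁ x₂ y₂, Real.sqrt
        (‖gradient (fun x => f x y₁) x₁ - gradient (fun x => f x y₂) x₂‖ ^ 2 +
         ‖gradient (f x₁) y₁ - gradient (f x₂) y₂‖ ^ 2) ≤
        Lf * Real.sqrt (‖x₁ - x₂‖ ^ 2 + ‖y₁ - y₂‖ ^ 2))
    (y0 : Vec d) (α : ℝ) (hα : 0 < α) (hαL : α ≤ 1 / max Lf Lg) (N : ℕ) :
    ∀ x₁ x₂ : Vec p,
      frob (Jn g α y0 N x₁ - Jn g α y0 N x₂) ≤
        (1 + max Lf Lg / μg) * (τ / μg + ρ * max Lf Lg / μg ^ 2) * ‖x₁ - x₂‖ := by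
  intro x₁ x₂
  have hL : 0 < max Lf Lg := by
    by_contra! h
    exact absurd (hα.trans_le hαL) (not_lt.2 (one_div_nonpos.2 h))
  have hαL' : α * max Lf Lg ≤ 1 := (le_div_iff₀ hL).1 hαL
  have hg2x (x : Vec p) : ContDiff ℝ 2 (g x) := hg2.comp (contDiff_prodMk_right x)
  have hHL (x : Vec p) (y : Vec d) : ‖fderiv ℝ (gradient (g x)) y‖ ≤ max Lf Lg := by
    refine norm_fderiv_le_of_lip' ℝ hL.le (Filter.Eventually.of_forall fun y' => ?_)
    have h := (Real.le_sqrt_of_sq_le (le_add_of_nonneg_left (sq_nonneg _))).trans (hLg x y' x y)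
    simp only [sub_self, norm_zero, ne_eq, OfNat.ofNat_ne_zero, not_false_eq_true, zero_pow,
      zero_add, Real.sqrt_sq (norm_nonneg _)] at h
    exact h.trans (by gcongr; exact le_max_right _ _)
  have hCL (x : Vec p) (y : Vec d) : ‖fderiv ℝ (fun x' => gradient (g x') y) x‖ ≤ max Lf Lg := by
    refine norm_fderiv_le_of_lip' ℝ hL.le (Filter.Eventually.of_forall fun x' => ?_)
    have h := (Real.le_sqrt_of_sq_le (le_add_of_nonneg_left (sq_nonneg _))).trans (hLg x' y x y)
    simp only [sub_self, norm_zero, ne_eq, OfNat.ofNat_ne_zero, not_false_eq_true, zero_pow,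
      add_zero, Real.sqrt_sq (norm_nonneg _)] at h
    exact h.trans (by gcongr; exact le_max_right _ _)
  rcases eq_or_ne x₁ x₂ with rfl | hx
  · simp [frob]
  have hx' : 0 < Real.sqrt (‖x₁ - x₂‖ ^ 2 + ‖(0 : Vec d) - 0‖ ^ 2) := by
    have := norm_pos_iff.2 (sub_ne_zero.2 hx)
    positivity
  have hρ0 : 0 ≤ ρ := nonneg_of_mul_nonneg_left ((frob_nonneg _).trans (hρ x₁ 0 x₂ 0)) hx'
  have hτ0 : 0 ≤ τ := nonneg_of_mul_nonneg_left ((frob_nonneg _).trans (hτ x₁ 0 x₂ 0)) hx'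
  have hH (x : Vec p) (y v : Vec d) :=
    norm_sub_smul_fderiv_gradient_le (hg2x x) (hsc x) (hHL x y) hα.le hαL' v
  rcases subsingleton_or_nontrivial (Vec d) with hd | hd
  · have h0 : frob (Jn g α y0 N x₁ - Jn g α y0 N x₂) = 0 := by
      simp [frob, Subsingleton.elim _ (0 : Vec d)]
    rw [h0]
    positivity
  · obtain ⟨v, hv⟩ := exists_ne (0 : Vec d)
    have hαμ : 0 ≤ 1 - α * μg :=
      nonneg_of_mul_nonneg_left ((norm_nonneg _).trans (hH x₁ 0 v)) (norm_pos_iff.2 hv)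
    exact frob_Jn_sub_le hg2 hα.le hμg (sub_nonneg.1 hαμ) hL.le hρ0 hτ0 hH hCL hρ hτ y0 N x₁ x₂
end
end

section
/- The total objective Φ has Lipschitz gradient: for all x₁, x₂ ∈ ℝ^p, ‖∇Φ(x₁) − ∇Φ(x₂)‖ ≤ L_Φ ‖x₁ − x₂‖, where L_Φ = L + (2L² + τM²)/μ_g + (ρLM + L³ + τML)/μ_g² + ρL²M/μ_g³. -/
open MeasureTheory ProbabilityTheory Real

noncomputable section

open Filter Topology Asymptotics

/-- First-order lower bound for a differentiable strongly convex function. -/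
lemma strongConvexOn_univ_add_fderiv_le {E : Type*} [NormedAddCommGroup E] [NormedSpace ℝ E]
    {φ : E → ℝ} {m : ℝ} (h : StrongConvexOn Set.univ m φ) {y : E}
    (hφ : DifferentiableAt ℝ φ y) (z : E) :
    φ y + fderiv ℝ φ y (z - y) + m / 2 * ‖z - y‖ ^ 2 ≤ φ z := by
  have hl : HasDerivAt (fun t : ℝ => φ (y + t • (z - y))) (fderiv ℝ φ y (z - y)) 0 :=
    hφ.hasFDerivAt.hasLineDerivAt (z - y)
  have h1 := (hasDerivAt_iff_tendsto_slope.1 hl).mono_left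
    (nhdsWithin_mono (0 : ℝ) (fun t (ht : t ∈ Set.Ioi (0 : ℝ)) => (ne_of_gt ht : t ≠ 0)))
  have h2 : Tendsto (fun t : ℝ => φ z - φ y - (1 - t) * (m / 2 * ‖z - y‖ ^ 2)) (𝓝[>] 0)
      (𝓝 (φ z - φ y - (1 - 0) * (m / 2 * ‖z - y‖ ^ 2))) :=
    (Continuous.tendsto (by fun_prop) 0).mono_left nhdsWithin_le_nhds
  have h3 := le_of_tendsto_of_tendsto h1 h2 (by
    filter_upwards [Ioo_mem_nhdsGT (zero_lt_one (α := ℝ))] with t ht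
    have := h.2 (Set.mem_univ z) (Set.mem_univ y) ht.1.le (sub_nonneg.2 ht.2.le)
      (by ring : t + (1 - t) = 1)
    have e : t • z + (1 - t) • y = y + t • (z - y) := by module
    rw [e] at this
    simp only [slope_def_field, zero_smul, add_zero, sub_zero, smul_eq_mul] at this ⊢
    rw [div_le_iff₀ ht.1]
    linarith)
  linarith

/-- The gradient of a differentiable strongly convex function expands distances. -/
lemma strongConvexOn_univ_norm_sub_le_gradient {E : Type*} [NormedAddCommGroup E]
    [InnerProductSpace ℝ E] [CompleteSpace E]
    {φ : E → ℝ} {m : ℝ} (h : StrongConvexOn Set.univ m φ) (hφ : Differentiable ℝ φ) (y z : E) :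
    m * ‖y - z‖ ≤ ‖gradient φ y - gradient φ z‖ := by
  have h1 := strongConvexOn_univ_add_fderiv_le h (hφ y) z
  have h2 := strongConvexOn_univ_add_fderiv_le h (hφ z) y
  rw [← inner_gradient_left] at h1 h2
  have h3 : inner ℝ (gradient φ y) (z - y) = - inner ℝ (gradient φ y) (y - z) := by
    rw [← inner_neg_right, neg_sub]
  have h4 := real_inner_le_norm (gradient φ y - gradient φ z) (y - z)
  rw [inner_sub_left] at h4
  rw [norm_sub_rev z y, h3] at h1
  rcases (norm_nonneg (y - z)).eq_or_lt' with h0 | h0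
  · rw [h0]; simp
  · refine le_of_mul_le_mul_right ?_ h0
    nlinarith

/-- The derivative of a map expanding distances expands norms by the same factor. -/
lemma HasFDerivAt.le_norm_apply_of_expanding {E F : Type*} [NormedAddCommGroup E]
    [NormedSpace ℝ E] [NormedAddCommGroup F] [NormedSpace ℝ F] {u : E → F} {A : E →L[ℝ] F}
    {m : ℝ} {y : E} (hu : HasFDerivAt u A y) (h : ∀ z, m * ‖z - y‖ ≤ ‖u z - u y‖) (v : E) :
    m * ‖v‖ ≤ ‖A v‖ := by
  have hl : HasDerivAt (fun t : ℝ => u (y + t • v)) (A v) 0 := hu.hasLineDerivAt v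
  refine le_of_tendsto_of_tendsto tendsto_const_nhds (hasDerivAt_iff_tendsto_slope.1 hl).norm ?_
  filter_upwards [self_mem_nhdsWithin] with t ht
  have := h (y + t • v)
  simp only [slope, vsub_eq_sub, sub_zero, zero_smul, add_zero, norm_smul, add_sub_cancel_left,
    norm_inv] at this ⊢
  have ht' : 0 < ‖t‖ := norm_pos_iff.2 ht
  rw [inv_mul_eq_div, le_div_iff₀ ht']
  linarith

/-- A Lipschitz solution of `G (x, u x) = 0` is differentiable where the partial derivative of `G`
in the second variable is invertible. -/
lemma hasFDerivAt_of_implicit {E F K : Type*} [NormedAddCommGroup E]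
    [NormedSpace ℝ E] [NormedAddCommGroup F] [NormedSpace ℝ F] [NormedAddCommGroup K]
    [NormedSpace ℝ K] {G : E × F → K} {u : E → F} {x : E} {B : E →L[ℝ] K} {H : F ≃L[ℝ] K}
    {C : NNReal} (hu : LipschitzWith C u) (h0 : ∀ z, G (z, u z) = 0)
    (hG : HasFDerivAt G (B.coprod (H : F →L[ℝ] K)) (x, u x)) :
    HasFDerivAt u (-((H.symm : K →L[ℝ] F).comp B)) x := by
  have ht : Tendsto (fun z => (z, u z)) (𝓝 x) (𝓝 (x, u x)) :=
    (continuous_id.prodMk hu.continuous).tendsto x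
  have h1 := hG.isLittleO.comp_tendsto ht
  have h2 : (fun z => (z, u z) - (x, u x)) =O[𝓝 x] (fun z => z - x) := by
    refine IsBigO.prod_left (isBigO_refl _ _) ?_
    exact IsBigO.of_bound C (Eventually.of_forall fun z => hu.norm_sub_le z x)
  have h3 := h1.trans_isBigO h2
  have h4 := ((H.symm : K →L[ℝ] F).isBigO_comp _ (𝓝 x)).trans_isLittleO h3
  rw [hasFDerivAt_iff_isLittleO]
  refine (h4.neg_left).congr_left fun z => ?_
  simp [h0]
  abel

lemma norm_apply_le_frob {n : ℕ} {F : Type*} [NormedAddCommGroup F] [NormedSpace ℝ F]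
    (A : Vec n →L[ℝ] F) (v : Vec n) : ‖A v‖ ≤ frob A * ‖v‖ := by
  have hv : v = ∑ j, v j • (EuclideanSpace.single j 1 : Vec n) := by
    ext i
    simp [Finset.sum_apply, Pi.single_apply]
  calc ‖A v‖ = ‖∑ j, v j • A (EuclideanSpace.single j 1)‖ := by
        conv_lhs => rw [hv]
        simp
    _ ≤ ∑ j, ‖A (EuclideanSpace.single j 1)‖ * ‖v j‖ :=
        norm_sum_le_of_le _ fun j _ => by rw [norm_smul, mul_comm]
    _ ≤ frob A * ‖v‖ := by
        rw [frob, EuclideanSpace.norm_eq]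
        exact Real.sum_mul_le_sqrt_mul_sqrt _ _ _

/-- If `m (1 + a) D ≤ l √(X² + a² D²)` for every `a ≥ 0`, then `m² (X² + D²) ≤ l² X²`. -/
lemma sq_mul_add_le_of_forall {m l X D : ℝ} (hm : 0 < m) (hml : m ≤ l) (hD : 0 ≤ D)
    (h : ∀ a : ℝ, 0 ≤ a → m * ((1 + a) * D) ≤ l * Real.sqrt (X ^ 2 + (a * D) ^ 2)) :
    m ^ 2 * (X ^ 2 + D ^ 2) ≤ l ^ 2 * X ^ 2 := by
  have h' : ∀ a : ℝ, 0 ≤ a → m ^ 2 * ((1 + a) * D) ^ 2 ≤ l ^ 2 * (X ^ 2 + (a * D) ^ 2) := by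
    intro a ha
    have := pow_le_pow_left₀ (by positivity) (h a ha) 2
    rwa [mul_pow, mul_pow l, Real.sq_sqrt (by positivity)] at this
  have hml2 : m ^ 2 ≤ l ^ 2 := pow_le_pow_left₀ hm.le hml 2
  rcases hml.eq_or_lt with rfl | hlt
  · suffices D = 0 by simp [this]
    by_contra hne
    have hD' : 0 < D ^ 2 := by positivity
    have := h' (X ^ 2 / D ^ 2) (by positivity)
    have h2 := le_of_mul_le_mul_left this (by positivity : 0 < m ^ 2)
    have e : X ^ 2 / D ^ 2 * D ^ 2 = X ^ 2 := by field_simp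
    nlinarith [sq_nonneg X]
  · have hlt2 : 0 < l ^ 2 - m ^ 2 := by nlinarith
    have := h' (m ^ 2 / (l ^ 2 - m ^ 2)) (by positivity)
    set a := m ^ 2 / (l ^ 2 - m ^ 2) with ha
    have e : a * (l ^ 2 - m ^ 2) = m ^ 2 := by rw [ha]; field_simp
    have e2 : m ^ 2 * (1 + a) = a * l ^ 2 := by linarith
    have e3 : m ^ 2 * ((1 + a) * D) ^ 2 = a * l ^ 2 * (1 + a) * D ^ 2 := by
      rw [← e2]; ring
    have e4 : l ^ 2 * (a * D ^ 2) ≤ l ^ 2 * X ^ 2 := by nlinarith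
    have e5 : a * l ^ 2 * D ^ 2 = m ^ 2 * (1 + a) * D ^ 2 := by rw [e2]
    have hl2 : 0 < l ^ 2 := by nlinarith
    have e6 := le_of_mul_le_mul_left e4 hl2
    have e7 := mul_le_mul_of_nonneg_left e6 hlt2.le
    nlinarith

lemma hasFDerivAt_coprod_fderiv {E F K : Type*} [NormedAddCommGroup E]
    [NormedSpace ℝ E] [NormedAddCommGroup F] [NormedSpace ℝ F] [NormedAddCommGroup K]
    [NormedSpace ℝ K] {G : E × F → K} {x : E} {y : F} (hG : DifferentiableAt ℝ G (x, y)) :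
    HasFDerivAt G ((fderiv ℝ (fun z => G (z, y)) x).coprod (fderiv ℝ (fun z => G (x, z)) y))
      (x, y) := by
  have h1 : HasFDerivAt (fun z => G (z, y)) _ x :=
    hG.hasFDerivAt.comp x (hasFDerivAt_prodMk_left x y)
  have h2 : HasFDerivAt (fun z => G (x, z)) _ y :=
    hG.hasFDerivAt.comp y (hasFDerivAt_prodMk_right x y)
  rw [h1.fderiv, h2.fderiv]
  convert hG.hasFDerivAt using 1
  ext v <;> simp

/-- The partial gradient of a `C²` function is `C¹`. -/
lemma contDiff_gradient_snd_s12 {E F : Type*} [NormedAddCommGroup E] [NormedSpace ℝ E]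
    [NormedAddCommGroup F] [InnerProductSpace ℝ F] [CompleteSpace F] {g : E → F → ℝ}
    (hg : ContDiff ℝ 2 (fun w : E × F => g w.1 w.2)) :
    ContDiff ℝ 1 (fun w : E × F => gradient (g w.1) w.2) := by
  have h1 : ContDiff ℝ 1 (fderiv ℝ (fun w : E × F => g w.1 w.2)) :=
    hg.fderiv_right (by norm_num)
  have h2 : (fun w : E × F => gradient (g w.1) w.2) = fun w =>
      (InnerProductSpace.toDual ℝ F).symm
        ((fderiv ℝ (fun w : E × F => g w.1 w.2) w).comp (ContinuousLinearMap.inr ℝ E F)) := by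
    funext w
    have hd : DifferentiableAt ℝ (fun w : E × F => g w.1 w.2) (w.1, w.2) :=
      (hg.differentiable (by norm_num)) _
    have h : HasFDerivAt (g w.1) _ w.2 :=
      hd.hasFDerivAt.comp w.2 (hasFDerivAt_prodMk_right w.1 w.2)
    rw [gradient, h.fderiv]
  rw [h2]
  exact (InnerProductSpace.toDual ℝ F).symm.contDiff.comp (h1.clm_comp contDiff_const)

lemma gradient_comp_graph_inner {E F : Type*} [NormedAddCommGroup E] [InnerProductSpace ℝ E]
    [CompleteSpace E] [NormedAddCommGroup F] [InnerProductSpace ℝ F] [CompleteSpace F]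
    {f : E → F → ℝ} (hf : Differentiable ℝ (fun w : E × F => f w.1 w.2)) {u : E → F} {x : E}
    {J : E →L[ℝ] F} (hu : HasFDerivAt u J x) (v : E) :
    inner ℝ (gradient (fun z => f z (u z)) x) v =
      inner ℝ (gradient (fun z => f z (u x)) x) v + inner ℝ (gradient (f x) (u x)) (J v) := by
  have h1 := hasFDerivAt_coprod_fderiv (hf (x, u x))
  have h2 : HasFDerivAt (fun z => f z (u z)) _ x :=
    HasFDerivAt.comp (f := fun z => (z, u z)) x h1 ((hasFDerivAt_id x).prodMk hu)
  simp [inner_gradient_left, h2.fderiv]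

lemma exists_continuousLinearEquiv_of_expanding {F : Type*} [NormedAddCommGroup F]
    [NormedSpace ℝ F] [FiniteDimensional ℝ F] {A : F →L[ℝ] F} {m : ℝ} (hm : 0 < m)
    (h : ∀ v, m * ‖v‖ ≤ ‖A v‖) : ∃ e : F ≃L[ℝ] F, (e : F →L[ℝ] F) = A := by
  have hinj : Function.Injective (A : F →ₗ[ℝ] F) := by
    rw [injective_iff_map_eq_zero]
    intro v hv
    have h1 := h v
    rw [show A v = 0 from hv, norm_zero] at h1
    have h2 : ‖v‖ ≤ 0 := by by_contra hc; nlinarith [mul_pos hm (not_le.1 hc)]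
    exact norm_le_zero_iff.1 h2
  exact ⟨(LinearEquiv.ofInjectiveEndo (A : F →ₗ[ℝ] F) hinj).toContinuousLinearEquiv, by
    ext v; simp⟩

/-- Two points on the graph of the minimizer map are at distance at most `l / m` times the distance
of their parameters. -/
lemma sqrt_graph_minimizer_le {E F : Type*} [NormedAddCommGroup E]
    [NormedAddCommGroup F] [InnerProductSpace ℝ F] [CompleteSpace F] [Nontrivial F]
    {g : E → F → ℝ} {m l : ℝ} (hm : 0 < m) (hg : ∀ x, Differentiable ℝ (g x))
    (hsc : ∀ x, StrongConvexOn Set.univ m (g x)) {u : E → F}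
    (h0 : ∀ x, gradient (g x) (u x) = 0)
    (hl : ∀ x₁ y₁ x₂ y₂, ‖gradient (g x₁) y₁ - gradient (g x₂) y₂‖ ≤
      l * Real.sqrt (‖x₁ - x₂‖ ^ 2 + ‖y₁ - y₂‖ ^ 2)) (x₁ x₂ : E) :
    Real.sqrt (‖x₁ - x₂‖ ^ 2 + ‖u x₁ - u x₂‖ ^ 2) ≤ l / m * ‖x₁ - x₂‖ := by
  have hml : m ≤ l := by
    obtain ⟨y, hy⟩ := exists_ne (0 : F)
    have h1 := strongConvexOn_univ_norm_sub_le_gradient (hsc x₁) (hg x₁) y 0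
    have h2 := h1.trans (hl x₁ y x₁ 0)
    simp only [sub_self, sub_zero, norm_zero, ne_eq, OfNat.ofNat_ne_zero, not_false_eq_true,
      zero_pow, zero_add, Real.sqrt_sq (norm_nonneg y)] at h2
    exact le_of_mul_le_mul_right h2 (norm_pos_iff.2 hy)
  have key := sq_mul_add_le_of_forall (X := ‖x₁ - x₂‖) hm hml (norm_nonneg (u x₁ - u x₂)) (by
    intro a ha
    have h1 := strongConvexOn_univ_norm_sub_le_gradient (hsc x₂) (hg x₂)
      (u x₁ + a • (u x₁ - u x₂)) (u x₂)
    have h2 := hl x₁ (u x₁) x₂ (u x₁ + a • (u x₁ - u x₂))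
    rw [h0, sub_zero] at h1
    rw [h0, zero_sub, norm_neg, sub_add_cancel_left, norm_neg, norm_smul, Real.norm_of_nonneg ha]
      at h2
    have e : u x₁ + a • (u x₁ - u x₂) - u x₂ = (1 + a) • (u x₁ - u x₂) := by module
    rw [e, norm_smul, Real.norm_of_nonneg (by linarith)] at h1
    exact h1.trans h2)
  have hl0 : 0 < l := hm.trans_le hml
  apply Real.sqrt_le_iff.2 ⟨by positivity, ?_⟩
  rw [mul_pow, div_pow, div_mul_eq_mul_div, le_div_iff₀ (by positivity)]
  linarith

/-- Solutions of `H₁ w₁ = -B₁ v` and `H₂ w₂ = -B₂ v` depend Lipschitz continuously on the data. -/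
lemma norm_sub_le_of_linear_systems {E F : Type*} [NormedAddCommGroup E] [NormedSpace ℝ E]
    [NormedAddCommGroup F] [NormedSpace ℝ F] {H₁ H₂ : F →L[ℝ] F} {B₁ B₂ : E →L[ℝ] F}
    {v : E} {w₁ w₂ : F} {m β η : ℝ} (h₁ : H₁ w₁ = -B₁ v) (h₂ : H₂ w₂ = -B₂ v)
    (hm : ∀ w, m * ‖w‖ ≤ ‖H₁ w‖) (hB : ‖(B₁ - B₂) v‖ ≤ β * ‖v‖)
    (hH : ‖(H₁ - H₂) w₂‖ ≤ η * ‖w₂‖) : m * ‖w₁ - w₂‖ ≤ β * ‖v‖ + η * ‖w₂‖ := by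
  have e : H₁ (w₁ - w₂) = -((B₁ - B₂) v + (H₁ - H₂) w₂) := by
    simp only [map_sub, sub_apply, h₁, h₂]
    abel
  calc m * ‖w₁ - w₂‖ ≤ ‖H₁ (w₁ - w₂)‖ := hm _
    _ ≤ ‖(B₁ - B₂) v‖ + ‖(H₁ - H₂) w₂‖ := by rw [e, norm_neg]; exact norm_add_le _ _
    _ ≤ _ := add_le_add hB hH

theorem statement12 {p d : ℕ} (f g : Vec p → Vec d → ℝ)
    (Lf Lg μg ρ τ M : ℝ) (hμg : 0 < μg)
    (hf2 : ContDiff ℝ 2 (fun w : Vec p × Vec d => f w.1 w.2))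
    (hg2 : ContDiff ℝ 2 (fun w : Vec p × Vec d => g w.1 w.2))
    (hsc : ∀ x, StrongConvexOn Set.univ μg (g x))
    (ystar : Vec p → Vec d)
    (hmin : ∀ x y, g x (ystar x) ≤ g x y)
    (hLg : ∀ x₁ y₁ x₂ y₂, Real.sqrt
        (‖gradient (fun x => g x y₁) x₁ - gradient (fun x => g x y₂) x₂‖ ^ 2 +
         ‖gradient (g x₁) y₁ - gradient (g x₂) y₂‖ ^ 2) ≤
        Lg * Real.sqrt (‖x₁ - x₂‖ ^ 2 + ‖y₁ - y₂‖ ^ 2))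
    (hρ : ∀ x₁ y₁ x₂ y₂,
        frob (fderiv ℝ (gradient (g x₁)) y₁ - fderiv ℝ (gradient (g x₂)) y₂) ≤
        ρ * Real.sqrt (‖x₁ - x₂‖ ^ 2 + ‖y₁ - y₂‖ ^ 2))
    (hτ : ∀ x₁ y₁ x₂ y₂,
        frob (fderiv ℝ (fun x => gradient (g x) y₁) x₁ -
              fderiv ℝ (fun x => gradient (g x) y₂) x₂) ≤
        τ * Real.sqrt (‖x₁ - x₂‖ ^ 2 + ‖y₁ - y₂‖ ^ 2))
    (hM : ∀ x₁ y₁ x₂ y₂, |f x₁ y₁ - f x₂ y₂| ≤ M * Real.sqrt (‖x₁ - x₂‖ ^ 2 + ‖y₁ - y₂‖ ^ 2))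
    (hLf : ∀ x₁ y₁ x₂ y₂, Real.sqrt
        (‖gradient (fun x => f x y₁) x₁ - gradient (fun x => f x y₂) x₂‖ ^ 2 +
         ‖gradient (f x₁) y₁ - gradient (f x₂) y₂‖ ^ 2) ≤
        Lf * Real.sqrt (‖x₁ - x₂‖ ^ 2 + ‖y₁ - y₂‖ ^ 2))
    :
    ∀ x₁ x₂ : Vec p,
      ‖gradient (fun x => f x (ystar x)) x₁ - gradient (fun x => f x (ystar x)) x₂‖ ≤
        (max Lf Lg + (2 * (max Lf Lg) ^ 2 + τ * M ^ 2) / μg +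
          (ρ * max Lf Lg * M + (max Lf Lg) ^ 3 + τ * M * max Lf Lg) / μg ^ 2 +
          ρ * (max Lf Lg) ^ 2 * M / μg ^ 3) * ‖x₁ - x₂‖ := by
  
  intro x₁ x₂
  rcases eq_or_ne x₁ x₂ with rfl | hne
  · simp
  have hX : 0 < ‖x₁ - x₂‖ := norm_pos_iff.2 (sub_ne_zero.2 hne)
  have hnn : ∀ {c q : ℝ}, 0 ≤ q →
      q ≤ c * Real.sqrt (‖x₁ - x₂‖ ^ 2 + ‖(0 : Vec d) - 0‖ ^ 2) → 0 ≤ c := by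
    intro c q hq h
    simp only [sub_self, norm_zero, ne_eq, OfNat.ofNat_ne_zero, not_false_eq_true, zero_pow,
      add_zero, Real.sqrt_sq hX.le] at h
    exact nonneg_of_mul_nonneg_left (hq.trans h) hX
  have hLf0 : 0 ≤ Lf := hnn (Real.sqrt_nonneg _) (hLf x₁ 0 x₂ 0)
  have hρ0 : 0 ≤ ρ := hnn (Real.sqrt_nonneg _) (hρ x₁ 0 x₂ 0)
  have hτ0 : 0 ≤ τ := hnn (Real.sqrt_nonneg _) (hτ x₁ 0 x₂ 0)
  have hM0 : 0 ≤ M := hnn (abs_nonneg _) (hM x₁ 0 x₂ 0)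
  set L := max Lf Lg with hL
  have hfL : Lf ≤ L := le_max_left _ _
  have hgL : Lg ≤ L := le_max_right _ _
  have hL0 : 0 ≤ L := hLf0.trans hfL
  have ha : ∀ y₁ y₂, ‖gradient (fun x => f x y₁) x₁ - gradient (fun x => f x y₂) x₂‖ ≤
      L * Real.sqrt (‖x₁ - x₂‖ ^ 2 + ‖y₁ - y₂‖ ^ 2) := fun y₁ y₂ =>
    ((Real.le_sqrt_of_sq_le (le_add_of_nonneg_right (sq_nonneg _))).trans (hLf x₁ y₁ x₂ y₂)).trans
      (by gcongr)
  rcases subsingleton_or_nontrivial (Vec d) with hd | hd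
  · have e : ystar = fun _ => 0 := Subsingleton.elim _ _
    have h1 := ha 0 0
    simp only [sub_self, norm_zero, ne_eq, OfNat.ofNat_ne_zero, not_false_eq_true, zero_pow,
      add_zero, Real.sqrt_sq hX.le] at h1
    rw [e]
    refine h1.trans (mul_le_mul_of_nonneg_right ?_ hX.le)
    rw [add_assoc, add_assoc]
    exact le_add_of_nonneg_right (by positivity)
  have hb : ∀ y₁ y₂, ‖gradient (f x₁) y₁ - gradient (f x₂) y₂‖ ≤
      L * Real.sqrt (‖x₁ - x₂‖ ^ 2 + ‖y₁ - y₂‖ ^ 2) := fun y₁ y₂ =>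
    ((Real.le_sqrt_of_sq_le (le_add_of_nonneg_left (sq_nonneg _))).trans (hLf x₁ y₁ x₂ y₂)).trans
      (by gcongr)
  have hl : ∀ x₁ y₁ x₂ y₂, ‖gradient (g x₁) y₁ - gradient (g x₂) y₂‖ ≤
      L * Real.sqrt (‖x₁ - x₂‖ ^ 2 + ‖y₁ - y₂‖ ^ 2) := fun x₁ y₁ x₂ y₂ =>
    ((Real.le_sqrt_of_sq_le (le_add_of_nonneg_left (sq_nonneg _))).trans (hLg x₁ y₁ x₂ y₂)).trans
      (by gcongr)
  have hgd : ∀ x, Differentiable ℝ (g x) := fun x =>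
    (hg2.differentiable (by norm_num)).comp
      ((differentiable_const x).prodMk differentiable_id)
  have h0 : ∀ x, gradient (g x) (ystar x) = 0 := fun x => by
    have : IsLocalMin (g x) (ystar x) := Eventually.of_forall (hmin x)
    rw [gradient, this.fderiv_eq_zero, map_zero]
  have hS := fun z₁ z₂ => sqrt_graph_minimizer_le hμg hgd hsc h0 hl z₁ z₂
  set κ := L / μg with hκ
  have hκ0 : 0 ≤ κ := by positivity
  have hlip : LipschitzWith κ.toNNReal ystar := LipschitzWith.of_dist_le_mul fun z₁ z₂ => by
    rw [Real.coe_toNNReal _ hκ0, dist_eq_norm, dist_eq_norm]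
    exact (Real.le_sqrt_of_sq_le (le_add_of_nonneg_left (sq_nonneg _))).trans (hS z₁ z₂)
  have hG := (contDiff_gradient_snd_s12 hg2).differentiable one_ne_zero
  have hH : ∀ x v, μg * ‖v‖ ≤ ‖fderiv ℝ (gradient (g x)) (ystar x) v‖ := fun x v => by
    have hd : DifferentiableAt ℝ (gradient (g x)) (ystar x) :=
      (hG.comp ((differentiable_const x).prodMk differentiable_id)) (ystar x)
    exact hd.hasFDerivAt.le_norm_apply_of_expanding
      (fun z => strongConvexOn_univ_norm_sub_le_gradient (hsc x) (hgd x) z (ystar x)) v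
  have hJ : ∀ x, ∃ J : Vec p →L[ℝ] Vec d, HasFDerivAt ystar J x ∧ ∀ v,
      fderiv ℝ (gradient (g x)) (ystar x) (J v) =
        -fderiv ℝ (fun z => gradient (g z) (ystar x)) x v := fun x => by
    obtain ⟨e, he⟩ := exists_continuousLinearEquiv_of_expanding hμg (hH x)
    have h1 := hasFDerivAt_coprod_fderiv (hG (x, ystar x))
    have h2 := hasFDerivAt_of_implicit (H := e)
      (B := fderiv ℝ (fun z => gradient (g z) (ystar x)) x) hlip h0 (by rw [he]; exact h1)
    refine ⟨_, h2, fun v => ?_⟩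
    rw [← he]
    simp
  obtain ⟨J₁, hJ₁, hE₁⟩ := hJ x₁
  obtain ⟨J₂, hJ₂, hE₂⟩ := hJ x₂
  have hJn : ∀ {x : Vec p} {J : Vec p →L[ℝ] Vec d}, HasFDerivAt ystar J x →
      ∀ v, ‖J v‖ ≤ κ * ‖v‖ := fun {x J} h v => by
    refine J.le_of_opNorm_le ?_ v
    have := h.le_of_lipschitz hlip
    rwa [Real.coe_toNNReal _ hκ0] at this
  have hbM : ‖gradient (f x₂) (ystar x₂)‖ ≤ M := by
    rw [gradient, LinearIsometryEquiv.norm_map]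
    refine norm_fderiv_le_of_lip' ℝ hM0 (Eventually.of_forall fun y => ?_)
    have := hM x₂ y x₂ (ystar x₂)
    simpa [Real.sqrt_sq (norm_nonneg _)] using this
  set S := Real.sqrt (‖x₁ - x₂‖ ^ 2 + ‖ystar x₁ - ystar x₂‖ ^ 2) with hSdef
  have hSκ : S ≤ κ * ‖x₁ - x₂‖ := hS x₁ x₂
  have hJd : ∀ v, ‖J₁ v - J₂ v‖ ≤ (τ * S + ρ * S * κ) / μg * ‖v‖ := fun v => by
    have h1 := norm_sub_le_of_linear_systems (hE₁ v) (hE₂ v) (hH x₁)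
      ((norm_apply_le_frob _ v).trans
        (mul_le_mul_of_nonneg_right (hτ x₁ (ystar x₁) x₂ (ystar x₂)) (norm_nonneg v)))
      ((norm_apply_le_frob _ _).trans
        (mul_le_mul_of_nonneg_right (hρ x₁ (ystar x₁) x₂ (ystar x₂)) (norm_nonneg _)))
    rw [div_mul_eq_mul_div, le_div_iff₀ hμg]
    have h2 : ρ * S * ‖J₂ v‖ ≤ ρ * S * (κ * ‖v‖) :=
      mul_le_mul_of_nonneg_left (hJn hJ₂ v) (by positivity)
    linarith
  have hfd := hf2.differentiable (by norm_num)
  have hmain : ∀ v, inner ℝ (gradient (fun x => f x (ystar x)) x₁ -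
      gradient (fun x => f x (ystar x)) x₂) v ≤
      (L * S + L * S * κ + M * ((τ * S + ρ * S * κ) / μg)) * ‖v‖ := fun v => by
    have e : inner ℝ (gradient (fun x => f x (ystar x)) x₁ -
        gradient (fun x => f x (ystar x)) x₂) v =
        inner ℝ (gradient (fun x => f x (ystar x₁)) x₁ -
          gradient (fun x => f x (ystar x₂)) x₂) v +
        inner ℝ (gradient (f x₁) (ystar x₁) - gradient (f x₂) (ystar x₂)) (J₁ v) +
        inner ℝ (gradient (f x₂) (ystar x₂)) (J₁ v - J₂ v) := by
      simp only [inner_sub_left, inner_sub_right, gradient_comp_graph_inner hfd hJ₁,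
        gradient_comp_graph_inner hfd hJ₂]
      ring
    have t1 := (real_inner_le_norm _ _).trans
      (mul_le_mul_of_nonneg_right (ha (ystar x₁) (ystar x₂)) (norm_nonneg v))
    have t2 := (real_inner_le_norm _ _).trans
      (mul_le_mul (hb (ystar x₁) (ystar x₂)) (hJn hJ₁ v) (norm_nonneg _) (by positivity))
    have t3 := (real_inner_le_norm _ _).trans
      (mul_le_mul hbM (hJd v) (norm_nonneg _) hM0)
    rw [e]
    linarith
  have hfin : ‖gradient (fun x => f x (ystar x)) x₁ - gradient (fun x => f x (ystar x)) x₂‖ ≤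
      L * S + L * S * κ + M * ((τ * S + ρ * S * κ) / μg) := by
    have := hmain (gradient (fun x => f x (ystar x)) x₁ - gradient (fun x => f x (ystar x)) x₂)
    rw [real_inner_self_eq_norm_mul_norm] at this
    rcases (norm_nonneg (gradient (fun x => f x (ystar x)) x₁ -
      gradient (fun x => f x (ystar x)) x₂)).eq_or_lt' with hz | hz
    · rw [hz]; positivity
    · exact le_of_mul_le_mul_right this hz
  calc _ ≤ L * S + L * S * κ + M * ((τ * S + ρ * S * κ) / μg) := hfin
    _ = (L + L * κ + M * ((τ + ρ * κ) / μg)) * S := by ring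
    _ ≤ (L + L * κ + M * ((τ + ρ * κ) / μg)) * (κ * ‖x₁ - x₂‖) := by gcongr
    _ = (L + L * κ + M * ((τ + ρ * κ) / μg)) * κ * ‖x₁ - x₂‖ := by ring
    _ ≤ _ := by
      gcongr
      have e : (L + (2 * L ^ 2 + τ * M ^ 2) / μg + (ρ * L * M + L ^ 3 + τ * M * L) / μg ^ 2 +
          ρ * L ^ 2 * M / μg ^ 3) = (L + L * κ + M * ((τ + ρ * κ) / μg)) * κ +
          (L + (L ^ 2 + τ * M ^ 2) / μg + ρ * L * M / μg ^ 2) := by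
        rw [hκ]
        field_simp
        ring
      rw [e]
      exact le_add_of_nonneg_right (by positivity)
end
end

section
/- The Gaussian smoothing h_μ is differentiable, and its gradient takes the form ∇h_μ(x) = E_u[ ((h(x + μu) − h(x))/μ) · u ] for every x ∈ ℝ^n. -/
open MeasureTheory ProbabilityTheory Real

noncomputable section

/-- The standard Gaussian measure on `ℝ^n` (mean zero, identity covariance). -/
def stdGaussian (n : ℕ) : Measure (Vec n) :=
  (Measure.pi fun _ : Fin n => gaussianReal 0 1).map (EuclideanSpace.equiv (Fin n) ℝ).symm

/-- Gaussian smooth approximation `h_μ(x) = E_u[h(x + μ u)]`. -/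
def smooth {n : ℕ} (h : Vec n → ℝ) (μ : ℝ) (x : Vec n) : ℝ :=
  ∫ u, h (x + μ • u) ∂(stdGaussian n)

section GaussianDensity

variable {ι : Type*} [Fintype ι]

lemma prod_gaussianPDFReal_zero_one (x : EuclideanSpace ℝ ι) :
    ∏ i, gaussianPDFReal 0 1 (x i) =
      (√(2 * π))⁻¹ ^ Fintype.card ι * exp (-‖x‖ ^ 2 / 2) := by
  simp only [gaussianPDFReal, Finset.prod_mul_distrib, ← Real.exp_sum,
    EuclideanSpace.real_norm_sq_eq]
  simp [Finset.sum_div, neg_div]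

lemma pi_gaussianReal_eq_withDensity :
    (Measure.pi fun _ : ι => gaussianReal 0 1) =
      volume.withDensity fun x : ι → ℝ => ENNReal.ofReal (∏ i, gaussianPDFReal 0 1 (x i)) := by
  refine Measure.pi_eq fun s hs => ?_
  rw [withDensity_apply _ (MeasurableSet.univ_pi hs), volume_pi, Measure.restrict_pi_pi,
    ← ofReal_integral_eq_lintegral_ofReal, integral_fintype_prod_eq_prod,
    ENNReal.ofReal_prod_of_nonneg]
  · refine Finset.prod_congr rfl fun i _ => ?_
    rw [gaussianReal_apply_eq_integral 0 one_ne_zero]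
  · exact fun i _ => integral_nonneg fun x => gaussianPDFReal_nonneg 0 1 x
  · exact Integrable.fintype_prod fun i => (integrable_gaussianPDFReal 0 1).restrict
  · exact ae_of_all _ fun x => Finset.prod_nonneg fun i _ => gaussianPDFReal_nonneg 0 1 _

lemma stdGaussian_eq_withDensity :
    ProbabilityTheory.stdGaussian (EuclideanSpace ℝ ι) =
      volume.withDensity fun x => ENNReal.ofReal
        ((√(2 * π))⁻¹ ^ Fintype.card ι * exp (-‖x‖ ^ 2 / 2)) := by
  rw [← map_pi_eq_stdGaussian, pi_gaussianReal_eq_withDensity]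
  ext s hs
  have hm : Measurable (WithLp.toLp 2 : (ι → ℝ) → EuclideanSpace ℝ ι) := by fun_prop
  rw [Measure.map_apply hm hs, withDensity_apply _ (hm hs), withDensity_apply _ hs,
    ← (EuclideanSpace.volume_preserving_symm_measurableEquiv_toLp ι).symm.setLIntegral_comp_preimage_emb
      (MeasurableEquiv.measurableEmbedding _)]
  simp only [← prod_gaussianPDFReal_zero_one]
  rfl

variable {F : Type*} [NormedAddCommGroup F] [NormedSpace ℝ F]

lemma integral_stdGaussian_eq (f : EuclideanSpace ℝ ι → F) :
    ∫ x, f x ∂(ProbabilityTheory.stdGaussian (EuclideanSpace ℝ ι)) =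
      ∫ x, ((√(2 * π))⁻¹ ^ Fintype.card ι * exp (-‖x‖ ^ 2 / 2)) • f x := by
  rw [stdGaussian_eq_withDensity, integral_withDensity_eq_integral_toReal_smul₀
    (by fun_prop) (ae_of_all _ fun _ => ENNReal.ofReal_lt_top)]
  refine integral_congr_ae (ae_of_all _ fun x => ?_)
  simp only
  rw [ENNReal.toReal_ofReal (by positivity)]

lemma integrable_stdGaussian_iff (f : EuclideanSpace ℝ ι → F) :
    Integrable f (ProbabilityTheory.stdGaussian (EuclideanSpace ℝ ι)) ↔
      Integrable fun x => ((√(2 * π))⁻¹ ^ Fintype.card ι * exp (-‖x‖ ^ 2 / 2)) • f x := by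
  rw [stdGaussian_eq_withDensity, integrable_withDensity_iff_integrable_smul₀'
    (by fun_prop) (ae_of_all _ fun _ => ENNReal.ofReal_lt_top)]
  refine integrable_congr (ae_of_all _ fun x => ?_)
  simp only
  rw [ENNReal.toReal_ofReal (by positivity)]

lemma hasFDerivAt_const_mul_exp_neg_norm_sq (c : ℝ) (x : EuclideanSpace ℝ ι) :
    HasFDerivAt (fun x : EuclideanSpace ℝ ι => c * exp (-‖x‖ ^ 2 / 2))
      (-(c * exp (-‖x‖ ^ 2 / 2)) • innerSL ℝ x) x := by
  have h := (((hasStrictFDerivAt_norm_sq x).hasFDerivAt.neg.mul_const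
    (2⁻¹ : ℝ)).exp).const_mul c
  simp only [Pi.neg_apply, ← div_eq_mul_inv] at h
  refine h.congr_fderiv ?_
  ext v
  simp
  ring

/-- The **Stein identity**: Gaussian integration by parts in the direction `v`. -/
theorem integral_fderiv_stdGaussian {g : EuclideanSpace ℝ ι → ℝ} (hg : Differentiable ℝ g)
    (v : EuclideanSpace ℝ ι)
    (hgi : Integrable g (ProbabilityTheory.stdGaussian (EuclideanSpace ℝ ι)))
    (hg' : Integrable (fun x => fderiv ℝ g x v)
      (ProbabilityTheory.stdGaussian (EuclideanSpace ℝ ι)))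
    (hgv : Integrable (fun x => g x * inner ℝ x v)
      (ProbabilityTheory.stdGaussian (EuclideanSpace ℝ ι))) :
    ∫ x, fderiv ℝ g x v ∂(ProbabilityTheory.stdGaussian (EuclideanSpace ℝ ι)) =
      ∫ x, g x * inner ℝ x v ∂(ProbabilityTheory.stdGaussian (EuclideanSpace ℝ ι)) := by
  rw [integrable_stdGaussian_iff] at hgi hg' hgv
  rw [integral_stdGaussian_eq, integral_stdGaussian_eq]
  set c : ℝ := (√(2 * π))⁻¹ ^ Fintype.card ι
  have hd := hasFDerivAt_const_mul_exp_neg_norm_sq (ι := ι) c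
  have hv (x : EuclideanSpace ℝ ι) :
      fderiv ℝ (fun x : EuclideanSpace ℝ ι => c * exp (-‖x‖ ^ 2 / 2)) x v * g x =
        -((c * exp (-‖x‖ ^ 2 / 2)) • (g x * inner ℝ x v)) := by
    rw [(hd x).fderiv]
    simp
    ring
  have h := integral_mul_fderiv_eq_neg_fderiv_mul_of_integrable (μ := volume) (v := v)
    (f := fun x : EuclideanSpace ℝ ι => c * exp (-‖x‖ ^ 2 / 2)) (g := g)
    (by simp only [hv]; exact hgv.neg) hg' hgi
    (fun x _ => (hd x).differentiableAt) (fun x _ => hg x)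
  simp only [hv, integral_neg, neg_neg] at h
  exact h

end GaussianDensity

lemma integrable_one_add_norm_pow {E : Type*} [NormedAddCommGroup E] [NormedSpace ℝ E]
    [MeasurableSpace E] [BorelSpace E] [CompleteSpace E] [SecondCountableTopology E]
    (γ : Measure E) [IsGaussian γ] (k : ℕ) : Integrable (fun u => (1 + ‖u‖) ^ k) γ := by
  have h1 : MemLp (fun u : E => ‖u‖) k γ := (IsGaussian.memLp_id γ k (by simp)).norm
  have h : MemLp (fun u : E => 1 + ‖u‖) k γ := (memLp_const (1 : ℝ)).add h1
  refine h.integrable_norm_pow'.congr (ae_of_all _ fun u => ?_)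
  simp only
  rw [Real.norm_of_nonneg (by positivity)]

lemma LipschitzWith.norm_le_mul_one_add_norm {E F : Type*} [NormedAddCommGroup E]
    [NormedAddCommGroup F] {f : E → F} {L : NNReal} (hf : LipschitzWith L f) (x : E) :
    ‖f x‖ ≤ (‖f 0‖ + L) * (1 + ‖x‖) := by
  have h1 := hf.norm_sub_le x 0
  have h2 := norm_le_insert' (f x) (f 0)
  rw [sub_zero] at h1
  nlinarith [norm_nonneg x, norm_nonneg (f 0), L.coe_nonneg]

section Growth

variable {E F : Type*} [NormedAddCommGroup E] [NormedSpace ℝ E]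
  [NormedAddCommGroup F] [NormedSpace ℝ F]

lemma norm_le_mul_one_add_norm_sq_of_fderiv {f : E → F} (hf : Differentiable ℝ f) {C : ℝ}
    (hC : 0 ≤ C) (hf' : ∀ x, ‖fderiv ℝ f x‖ ≤ C * (1 + ‖x‖)) (x : E) :
    ‖f x‖ ≤ (‖f 0‖ + C) * (1 + ‖x‖) ^ 2 := by
  have h1 : ‖f x - f 0‖ ≤ C * (1 + ‖x‖) * ‖x - 0‖ :=
    (convex_closedBall (0 : E) ‖x‖).norm_image_sub_le_of_norm_fderiv_le (𝕜 := ℝ)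
      (fun y _ => hf y)
      (fun y hy => (hf' y).trans (by
        have : ‖y‖ ≤ ‖x‖ := by simpa using hy
        gcongr))
      (by simp) (by simp)
  have h2 := norm_le_insert' (f x) (f 0)
  rw [sub_zero] at h1
  have h3 : 0 ≤ C * ‖x‖ := by positivity
  have h4 : 0 ≤ ‖f 0‖ * ‖x‖ := by positivity
  have h5 : 0 ≤ ‖f 0‖ * ‖x‖ ^ 2 := by positivity
  nlinarith

lemma one_add_norm_add_smul_le {μ : ℝ} (hμ : 0 ≤ μ) (x u : E) :
    1 + ‖x + μ • u‖ ≤ (1 + ‖x‖ + μ) * (1 + ‖u‖) := by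
  have h := norm_add_le x (μ • u)
  rw [norm_smul, Real.norm_of_nonneg hμ] at h
  nlinarith [norm_nonneg x, norm_nonneg u, mul_nonneg (norm_nonneg x) (norm_nonneg u)]

variable {h : E → ℝ} {C : ℝ}

lemma norm_comp_add_smul_le (hd : Differentiable ℝ h) (hC : 0 ≤ C)
    (hC' : ∀ x, ‖fderiv ℝ h x‖ ≤ C * (1 + ‖x‖)) {μ : ℝ} (hμ : 0 ≤ μ) (x u : E) :
    ‖h (x + μ • u)‖ ≤ (‖h 0‖ + C) * (1 + ‖x‖ + μ) ^ 2 * (1 + ‖u‖) ^ 2 := by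
  refine (norm_le_mul_one_add_norm_sq_of_fderiv hd hC hC' _).trans ?_
  rw [mul_assoc, ← mul_pow]
  gcongr
  exact one_add_norm_add_smul_le hμ x u

lemma norm_fderiv_add_smul_le (hC : 0 ≤ C)
    (hC' : ∀ x, ‖fderiv ℝ h x‖ ≤ C * (1 + ‖x‖)) {μ : ℝ} (hμ : 0 ≤ μ) (x u : E) :
    ‖fderiv ℝ h (x + μ • u)‖ ≤ C * (1 + ‖x‖ + μ) * (1 + ‖u‖) ^ 1 := by
  refine (hC' _).trans ?_
  rw [mul_assoc, pow_one]
  gcongr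
  exact one_add_norm_add_smul_le hμ x u

end Growth

section Smoothing

variable {E : Type*} [NormedAddCommGroup E] [NormedSpace ℝ E] [MeasurableSpace E] [BorelSpace E]
  [CompleteSpace E] [SecondCountableTopology E] {γ : Measure E} [IsGaussian γ]

lemma integrable_of_norm_le_mul_one_add_norm_pow {F : Type*} [NormedAddCommGroup F]
    {f : E → F} (hf : AEStronglyMeasurable f γ) {C : ℝ} {k : ℕ}
    (hC : ∀ u, ‖f u‖ ≤ C * (1 + ‖u‖) ^ k) : Integrable f γ :=
  ((integrable_one_add_norm_pow γ k).const_mul C).mono' hf (ae_of_all _ hC)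

variable {h : E → ℝ} {C : ℝ}

lemma hasFDerivAt_integral_add_smul (hd : Differentiable ℝ h) (hc : Continuous (fderiv ℝ h))
    (hC : 0 ≤ C) (hC' : ∀ x, ‖fderiv ℝ h x‖ ≤ C * (1 + ‖x‖)) {μ : ℝ} (hμ : 0 ≤ μ) (x : E) :
    HasFDerivAt (fun x => ∫ u, h (x + μ • u) ∂γ) (∫ u, fderiv ℝ h (x + μ • u) ∂γ) x := by
  have hh : Continuous h := hd.continuous
  refine hasFDerivAt_integral_of_dominated_of_fderiv_le (𝕜 := ℝ)
    (F' := fun y u => fderiv ℝ h (y + μ • u))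
    (bound := fun u => C * (1 + (‖x‖ + 1) + μ) * (1 + ‖u‖) ^ 1)
    (Metric.ball_mem_nhds x one_pos) (.of_forall fun y => ?_) ?_ ?_
    (ae_of_all _ fun u y hy => ?_) ((integrable_one_add_norm_pow γ 1).const_mul _)
    (ae_of_all _ fun u y _ => ?_)
  · exact (by fun_prop : Continuous fun u => h (y + μ • u)).aestronglyMeasurable
  · exact integrable_of_norm_le_mul_one_add_norm_pow
      (by fun_prop : Continuous fun u => h (x + μ • u)).aestronglyMeasurable
      (norm_comp_add_smul_le hd hC hC' hμ x)
  · exact (by fun_prop : Continuous fun u => fderiv ℝ h (x + μ • u)).aestronglyMeasurable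
  · refine (norm_fderiv_add_smul_le hC hC' hμ y u).trans ?_
    have hy' : ‖y‖ ≤ ‖x‖ + 1 := by
      have h1 := norm_le_insert' y x
      have h2 : ‖y - x‖ < 1 := by simpa [dist_eq_norm] using hy
      linarith
    gcongr
  · exact (hasFDerivAt_comp_add_right (μ • u)).2 (hd _).hasFDerivAt

end Smoothing

theorem statement14 {n : ℕ} (h : Vec n → ℝ) (hd : Differentiable ℝ h)
    (L : NNReal) (hL : LipschitzWith L (gradient h)) (μ : ℝ) (hμ : 0 < μ) :
    Differentiable ℝ (smooth h μ) ∧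
    ∀ x : Vec n,
      gradient (smooth h μ) x = ∫ u, ((h (x + μ • u) - h x) / μ) • u ∂(stdGaussian n) := by
  have hγ : _root_.stdGaussian n = ProbabilityTheory.stdGaussian (Vec n) :=
    map_pi_eq_stdGaussian
  have hL' : LipschitzWith L (fderiv ℝ h) := LipschitzWith.of_dist_le_mul fun x y => by
    simpa [gradient] using hL.dist_le_mul x y
  have hc := hL'.continuous
  have hh := hd.continuous
  have hC : 0 ≤ ‖fderiv ℝ h 0‖ + L := by positivity
  have hC' := hL'.norm_le_mul_one_add_norm
  set C : ℝ := ‖fderiv ℝ h 0‖ + L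
  set γ := ProbabilityTheory.stdGaussian (Vec n)
  have hs (x : Vec n) :
      HasFDerivAt (smooth h μ) (∫ u, fderiv ℝ h (x + μ • u) ∂γ) x := by
    unfold smooth
    rw [hγ]
    exact hasFDerivAt_integral_add_smul hd hc hC hC' hμ.le x
  refine ⟨fun x => (hs x).differentiableAt, fun x => ?_⟩
  rw [hγ]
  set g : Vec n → ℝ := fun u => (h (x + μ • u) - h x) / μ with hg
  have hgc : Continuous g := by fun_prop
  have hgd (u : Vec n) : HasFDerivAt g (fderiv ℝ h (x + μ • u)) u := by
    have h1 : HasFDerivAt (fun u : Vec n => x + μ • u) (μ • ContinuousLinearMap.id ℝ (Vec n)) u :=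
      ((hasFDerivAt_id u).const_smul μ).const_add x
    have h2 := (((hd (x + μ • u)).hasFDerivAt.comp u h1).sub_const (h x)).mul_const μ⁻¹
    simp only [← div_eq_mul_inv] at h2
    refine h2.congr_fderiv ?_
    ext v
    simp [hμ.ne']
  have hgi : Integrable g γ := by
    refine Integrable.div_const (Integrable.sub ?_ (integrable_const _)) μ
    exact integrable_of_norm_le_mul_one_add_norm_pow (by fun_prop)
      (norm_comp_add_smul_le hd hC hC' hμ.le x)
  have hgb (u : Vec n) : ‖g u • u‖ ≤
      ((‖h 0‖ + C) * (1 + ‖x‖ + μ) ^ 2 + ‖h x‖) / μ * (1 + ‖u‖) ^ 3 := by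
    have h1 := norm_sub_le (h (x + μ • u)) (h x)
    have h2 := norm_comp_add_smul_le hd hC hC' hμ.le x u
    have h3 : ‖h x‖ ≤ ‖h x‖ * (1 + ‖u‖) ^ 2 :=
      le_mul_of_one_le_right (norm_nonneg _) (one_le_pow₀ (by simp))
    rw [norm_smul, hg, norm_div, Real.norm_of_nonneg hμ.le, pow_succ (1 + ‖u‖) 2, ← mul_assoc,
      div_mul_eq_mul_div _ μ ((1 + ‖u‖) ^ 2)]
    refine mul_le_mul (div_le_div_of_nonneg_right ?_ hμ.le) ?_ (norm_nonneg u) (by positivity)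
    · linarith
    · linarith
  have hgu : Integrable (fun u => g u • u) γ :=
    integrable_of_norm_le_mul_one_add_norm_pow (by fun_prop) hgb
  have hfi : Integrable (fun u => fderiv ℝ h (x + μ • u)) γ :=
    integrable_of_norm_le_mul_one_add_norm_pow
      (by fun_prop : Continuous fun u => fderiv ℝ h (x + μ • u)).aestronglyMeasurable
      (norm_fderiv_add_smul_le hC hC' hμ.le x)
  refine ext_inner_right ℝ fun v => ?_
  have hinner (u : Vec n) : inner ℝ v (g u • u) = g u * inner ℝ u v := by
    rw [real_inner_smul_right, real_inner_comm]
  have hstein := integral_fderiv_stdGaussian (fun u => (hgd u).differentiableAt) v hgi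
    (by simpa only [fun u => (hgd u).fderiv] using hfi.apply_continuousLinearMap v)
    (by simpa only [hinner] using hgu.const_inner (𝕜 := ℝ) v)
  rw [real_inner_comm v (∫ u, _ ∂γ), ← integral_inner hgu]
  simp only [hinner]
  rw [← hstein, gradient, InnerProductSpace.toDual_symm_apply, (hs x).fderiv,
    ContinuousLinearMap.integral_apply hfi]
  simp only [fun u => (hgd u).fderiv]
  rfl
end
end
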